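/- Completeness of RTDC: for all data α and β, if α ≃_RT β (in every regular model, α and β have exactly the same truthmakers) then there is an RTDC-deduction of β from α. -/

import Mathlib

/-- Formulas of classical propositional logic: propositional variables,
negation, conjunction, disjunction. -/
inductive Fml : Type
  | var : ℕ → Fml
  | neg : Fml → Fml
  | conj : Fml → Fml → Fml
  | disj : Fml → Fml → Fml
  deriving DecidableEq

/-- A datum: a finite set of finite sets (components) of formulas. -/
abbrev Datum := Finset (Finset Fml)

/-- Truth-value of a formula under an interpretation of the variables. -/
def Fml.eval (v : ℕ → Bool) : Fml → Bool
  | .var n => v n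
  | .neg A => !A.eval v
  | .conj A B => A.eval v && B.eval v
  | .disj A B => A.eval v || B.eval v

/-- An interpretation verifies a datum iff some component has all its
formulas true. -/
def Verifies (v : ℕ → Bool) (α : Datum) : Prop :=
  ∃ Γ ∈ α, ∀ A ∈ Γ, A.eval v = true

/-- The analytic G-rules of the Data Calculus DC. -/
inductive GStep : Datum → Datum → Prop
  | conj (Γ : Finset Fml) (A B : Fml) (ρ : Datum) :
      GStep (insert (insert (Fml.conj A B) Γ) ρ)
            (insert (insert A (insert B Γ)) ρ)
  | disj (Γ : Finset Fml) (A B : Fml) (ρ : Datum) :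
      GStep (insert (insert (Fml.disj A B) Γ) ρ)
            (insert (insert A Γ) (insert (insert B Γ) ρ))
  | negneg (Γ : Finset Fml) (A : Fml) (ρ : Datum) :
      GStep (insert (insert (Fml.neg (Fml.neg A)) Γ) ρ)
            (insert (insert A Γ) ρ)
  | negdisj (Γ : Finset Fml) (A B : Fml) (ρ : Datum) :
      GStep (insert (insert (Fml.neg (Fml.disj A B)) Γ) ρ)
            (insert (insert (Fml.neg A) (insert (Fml.neg B) Γ)) ρ)
  | negconj (Γ : Finset Fml) (A B : Fml) (ρ : Datum) :
      GStep (insert (insert (Fml.neg (Fml.conj A B)) Γ) ρ)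
            (insert (insert (Fml.neg A) Γ) (insert (insert (Fml.neg B) Γ) ρ))

/-- The analytic N-rule NC: delete a component containing a pair A, ¬A. -/
def NCStep (α β : Datum) : Prop :=
  ∃ (Γ : Finset Fml) (A : Fml),
    α = insert (insert A (insert (Fml.neg A) Γ)) β

/-- The synthetic N-rule EM: replace a component Γ by the two components
Γ∪{A} and Γ∪{¬A}. -/
def EMStep (α β : Datum) : Prop :=
  ∃ (Γ : Finset Fml) (A : Fml) (ρ : Datum),
    α = insert Γ ρ ∧
    β = insert (insert A Γ) (insert (insert (Fml.neg A) Γ) ρ)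

/-- The analytic S-rule Del: replace a component Γ∪Δ by its subset Γ. -/
def DelStep (α β : Datum) : Prop :=
  ∃ (Γ Δ : Finset Fml) (ρ : Datum),
    α = insert (Γ ∪ Δ) ρ ∧ β = insert Γ ρ

/-- The synthetic S-rule Exp: add an arbitrary new component. -/
def ExpStep (α β : Datum) : Prop :=
  ∃ Γ : Finset Fml, β = insert Γ α

/-- Closure of a set of states under (nonempty) fusions. -/
def FusCl {S : Type} (X : Set (Set S)) : Set (Set S) :=
  {s | ∃ Y ⊆ X, Y.Nonempty ∧ s = ⋃₀ Y}

/-- Closure of a set of states under intermediates. -/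
def IntCl {S : Type} (X : Set (Set S)) : Set (Set S) :=
  {s | ∃ s₁ ∈ X, ∃ s₂ ∈ X, s₁ ⊆ s ∧ s ⊆ s₂}

/-- The regular closure: intermediates of fusions. -/
def RCl {S : Type} (X : Set (Set S)) : Set (Set S) :=
  IntCl (FusCl X)

/-- A regular bilateral proposition: the truthmaker and falsity-maker sets
are distinct, nonempty, and each closed under fusions and intermediates. -/
def RegularProp {S : Type} (P : Set (Set S) × Set (Set S)) : Prop :=
  P.1 ≠ P.2 ∧ P.1.Nonempty ∧ P.2.Nonempty ∧
    FusCl P.1 = P.1 ∧ IntCl P.1 = P.1 ∧ FusCl P.2 = P.2 ∧ IntCl P.2 = P.2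

/-- The regular truthmaker semantics: as the exact semantics but applying
the closure Int Cl(Fus Cl(·)) at each stage. -/
def RSem {S : Type} (σ : ℕ → Set (Set S) × Set (Set S)) :
    Fml → Set (Set S) × Set (Set S)
  | .var p => σ p
  | .neg A => ((RSem σ A).2, (RSem σ A).1)
  | .conj A B =>
      (RCl {s | ∃ s₁ ∈ (RSem σ A).1, ∃ s₂ ∈ (RSem σ B).1, s = s₁ ∪ s₂},
       RCl ((RSem σ A).2 ∪ (RSem σ B).2))
  | .disj A B =>
      (RCl ((RSem σ A).1 ∪ (RSem σ B).1),
       RCl {s | ∃ s₁ ∈ (RSem σ A).2, ∃ s₂ ∈ (RSem σ B).2, s = s₁ ∪ s₂})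

/-- The regular truthmakers of a component, read as the conjunction of its
formulas. -/
def RCompTM {S : Type} (σ : ℕ → Set (Set S) × Set (Set S)) (Γ : Finset Fml) :
    Set (Set S) :=
  RCl {s | ∃ f : Fml → Set S,
        (∀ A ∈ Γ, f A ∈ (RSem σ A).1) ∧ s = ⋃ A ∈ Γ, f A}

/-- The regular truthmakers of a datum, read as the disjunction of its
components. -/
def RDatumTM {S : Type} (σ : ℕ → Set (Set S) × Set (Set S)) (α : Datum) :
    Set (Set S) :=
  RCl (⋃ Γ ∈ α, RCompTM σ Γ)

/-- The Fusion rule ↑Fus: in the presence of components Γ and Δ, add the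
component Γ∪Δ. (Its inverse is ↓Fus.) -/
def FusAdd (α β : Datum) : Prop :=
  ∃ (Γ Δ : Finset Fml) (ρ : Datum),
    α = insert Γ (insert Δ ρ) ∧ β = insert Γ (insert Δ (insert (Γ ∪ Δ) ρ))

/-- The Intermediate rule ↑Int: in the presence of components Γ and Γ∪Δ∪Θ,
add the component Γ∪Δ. (Its inverse is ↓Int.) -/
def IntAdd (α β : Datum) : Prop :=
  ∃ (Γ Δ Θ : Finset Fml) (ρ : Datum),
    α = insert Γ (insert (Γ ∪ Δ ∪ Θ) ρ) ∧
    β = insert Γ (insert (Γ ∪ Δ) (insert (Γ ∪ Δ ∪ Θ) ρ))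

/-- One step of RTDC: G-rules, Fusion rules and Intermediate rules, each in
both directions. -/
def RTDCStep (α β : Datum) : Prop :=
  GStep α β ∨ GStep β α ∨ FusAdd α β ∨ FusAdd β α ∨ IntAdd α β ∨ IntAdd β α

/-- RT equivalence of data: the same truthmakers in every regular model. -/
def RTEquiv (α β : Datum) : Prop :=
  ∀ (S : Type) (σ : ℕ → Set (Set S) × Set (Set S)),
    (∀ p : ℕ, RegularProp (σ p)) → RDatumTM σ α = RDatumTM σ β

section RTDCProof
open Relation

/-! ### Closure -/

def Ten {S : Type} (X Y : Set (Set S)) : Set (Set S) :=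
  {s | ∃ s₁ ∈ X, ∃ s₂ ∈ Y, s = s₁ ∪ s₂}

theorem mem_RCl {S : Type} {X : Set (Set S)} {s : Set S} :
    s ∈ RCl X ↔ ∃ A ⊆ X, ∃ B ⊆ X, A.Nonempty ∧ B.Nonempty ∧ ⋃₀ A ⊆ s ∧ s ⊆ ⋃₀ B := by
  constructor
  · rintro ⟨a, ⟨A, hA, hA', rfl⟩, b, ⟨B, hB, hB', rfl⟩, h1, h2⟩
    exact ⟨A, hA, B, hB, hA', hB', h1, h2⟩
  · rintro ⟨A, hA, B, hB, hA', hB', h1, h2⟩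
    exact ⟨_, ⟨A, hA, hA', rfl⟩, _, ⟨B, hB, hB', rfl⟩, h1, h2⟩

theorem subset_RCl {S : Type} (X : Set (Set S)) : X ⊆ RCl X := by
  intro s hs
  rw [mem_RCl]
  exact ⟨{s}, by simpa using hs, {s}, by simpa using hs, by simp, by simp, by simp, by simp⟩

theorem RCl_mono {S : Type} {X Y : Set (Set S)} (h : X ⊆ Y) : RCl X ⊆ RCl Y := by
  intro s hs
  rw [mem_RCl] at *
  obtain ⟨A, hA, B, hB, h'⟩ := hs
  exact ⟨A, hA.trans h, B, hB.trans h, h'⟩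

theorem RCl_idem {S : Type} (X : Set (Set S)) : RCl (RCl X) = RCl X := by
  apply Set.Subset.antisymm _ (subset_RCl _)
  intro s hs
  rw [mem_RCl] at hs
  obtain ⟨A, hA, B, hB, ⟨a0, ha0⟩, ⟨b0, hb0⟩, h1, h2⟩ := hs
  rw [mem_RCl]
  refine ⟨{x ∈ X | x ⊆ s}, fun x hx => hx.1, X, subset_rfl, ?_, ?_, ?_, ?_⟩
  · obtain ⟨A', hA', B', hB', ⟨x, hx⟩, _, h3, h4⟩ := mem_RCl.1 (hA ha0)
    exact ⟨x, hA' hx, (Set.subset_sUnion_of_mem hx).trans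
      (h3.trans ((Set.subset_sUnion_of_mem ha0).trans h1))⟩
  · obtain ⟨A', hA', B', hB', ⟨x, hx⟩, _, h3, h4⟩ := mem_RCl.1 (hA ha0)
    exact ⟨x, hA' hx⟩
  · exact Set.sUnion_subset fun x hx => hx.2
  · refine h2.trans (Set.sUnion_subset fun b hb => ?_)
    obtain ⟨A', hA', B', hB', _, _, h3, h4⟩ := mem_RCl.1 (hB hb)
    exact h4.trans (Set.sUnion_subset_sUnion hB')

theorem RCl_le {S : Type} {X Y : Set (Set S)} (h : X ⊆ RCl Y) : RCl X ⊆ RCl Y := by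
  have := RCl_mono h
  rwa [RCl_idem] at this

theorem RCl_union {S : Type} (X Y : Set (Set S)) : RCl (RCl X ∪ Y) = RCl (X ∪ Y) := by
  apply Set.Subset.antisymm
  · apply RCl_le
    apply Set.union_subset
    · exact RCl_mono Set.subset_union_left
    · exact Set.subset_union_right.trans (subset_RCl _)
  · exact RCl_mono (Set.union_subset_union_left _ (subset_RCl _))

theorem RCl_union' {S : Type} (X Y : Set (Set S)) : RCl (X ∪ RCl Y) = RCl (X ∪ Y) := by
  rw [Set.union_comm, RCl_union, Set.union_comm]

theorem Ten_comm {S : Type} (X Y : Set (Set S)) : Ten X Y = Ten Y X := by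
  ext s
  constructor <;> rintro ⟨a, ha, b, hb, rfl⟩ <;> exact ⟨b, hb, a, ha, Set.union_comm _ _⟩

theorem Ten_assoc {S : Type} (X Y Z : Set (Set S)) : Ten (Ten X Y) Z = Ten X (Ten Y Z) := by
  ext s
  constructor
  · rintro ⟨_, ⟨a, ha, b, hb, rfl⟩, c, hc, rfl⟩
    exact ⟨a, ha, _, ⟨b, hb, c, hc, rfl⟩, Set.union_assoc _ _ _⟩
  · rintro ⟨a, ha, _, ⟨b, hb, c, hc, rfl⟩, rfl⟩
    exact ⟨_, ⟨a, ha, b, hb, rfl⟩, c, hc, (Set.union_assoc _ _ _).symm⟩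

theorem Ten_union {S : Type} (X Y Z : Set (Set S)) : Ten (X ∪ Y) Z = Ten X Z ∪ Ten Y Z := by
  ext s
  constructor
  · rintro ⟨a, ha | ha, b, hb, rfl⟩
    · exact Or.inl ⟨a, ha, b, hb, rfl⟩
    · exact Or.inr ⟨a, ha, b, hb, rfl⟩
  · rintro (⟨a, ha, b, hb, rfl⟩ | ⟨a, ha, b, hb, rfl⟩)
    · exact ⟨a, Or.inl ha, b, hb, rfl⟩
    · exact ⟨a, Or.inr ha, b, hb, rfl⟩

theorem Ten_mono {S : Type} {X X' Y : Set (Set S)} (h : X ⊆ X') : Ten X Y ⊆ Ten X' Y := by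
  rintro s ⟨a, ha, b, hb, rfl⟩
  exact ⟨a, h ha, b, hb, rfl⟩

theorem RCl_Ten {S : Type} (X Y : Set (Set S)) : RCl (Ten (RCl X) Y) = RCl (Ten X Y) := by
  apply Set.Subset.antisymm
  · apply RCl_le
    rintro s ⟨a, ha, b, hb, rfl⟩
    obtain ⟨A, hA, B, hB, ⟨a0, ha0⟩, ⟨b0, hb0⟩, h1, h2⟩ := mem_RCl.1 ha
    refine mem_RCl.2 ⟨(· ∪ b) '' A, ?_, (· ∪ b) '' B, ?_, ⟨_, a0, ha0, rfl⟩,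
      ⟨_, b0, hb0, rfl⟩, ?_, ?_⟩
    · rintro _ ⟨x, hx, rfl⟩
      exact ⟨x, hA hx, b, hb, rfl⟩
    · rintro _ ⟨x, hx, rfl⟩
      exact ⟨x, hB hx, b, hb, rfl⟩
    · apply Set.sUnion_subset
      rintro _ ⟨x, hx, rfl⟩
      exact Set.union_subset_union_left _ ((Set.subset_sUnion_of_mem hx).trans h1)
    · rintro x (hx | hx)
      · obtain ⟨t, ht, hxt⟩ := h2 hx
        exact ⟨_, ⟨t, ht, rfl⟩, Or.inl hxt⟩
      · exact ⟨_, ⟨b0, hb0, rfl⟩, Or.inr hx⟩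
  · exact RCl_mono (Ten_mono (subset_RCl _))

theorem RCl_Ten' {S : Type} (X Y : Set (Set S)) : RCl (Ten X (RCl Y)) = RCl (Ten X Y) := by
  rw [Ten_comm, RCl_Ten, Ten_comm]

theorem RCl_singleton {S : Type} (x : Set S) : RCl {x} = {x} := by
  apply Set.Subset.antisymm _ (subset_RCl _)
  intro s hs
  obtain ⟨A, hA, B, hB, hA', hB', h1, h2⟩ := mem_RCl.1 hs
  rw [(Set.Nonempty.subset_singleton_iff hA').1 hA] at h1
  rw [(Set.Nonempty.subset_singleton_iff hB').1 hB] at h2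
  simp at h1 h2
  exact Set.Subset.antisymm h2 h1

theorem union_mem_of_closed {S : Type} {X : Set (Set S)} (h : RCl X = X) {a b : Set S}
    (ha : a ∈ X) (hb : b ∈ X) : a ∪ b ∈ X := by
  rw [← h, mem_RCl]
  have : ({a, b} : Set (Set S)) ⊆ X := by
    rintro x (rfl | rfl) <;> assumption
  exact ⟨{a, b}, this, {a, b}, this, by simp, by simp, by simp, by simp⟩

/-! ### Soundness of the G-rules -/

variable {S : Type} {σ : ℕ → Set (Set S) × Set (Set S)}

theorem RSem_closed (hσ : ∀ p, RCl (σ p).1 = (σ p).1 ∧ RCl (σ p).2 = (σ p).2) (A : Fml) :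
    RCl (RSem σ A).1 = (RSem σ A).1 ∧ RCl (RSem σ A).2 = (RSem σ A).2 := by
  induction A with
  | var p => exact hσ p
  | neg A ih => exact ⟨ih.2, ih.1⟩
  | conj A B _ _ => exact ⟨RCl_idem _, RCl_idem _⟩
  | disj A B _ _ => exact ⟨RCl_idem _, RCl_idem _⟩

theorem RCompTM_insert (hσ : ∀ p, RCl (σ p).1 = (σ p).1 ∧ RCl (σ p).2 = (σ p).2)
    (A : Fml) (Γ : Finset Fml) :
    RCompTM σ (insert A Γ) = RCl (Ten (RSem σ A).1 (RCompTM σ Γ)) := by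
  unfold RCompTM
  rw [RCl_Ten']
  congr 1
  ext s
  constructor
  · rintro ⟨f, hf, rfl⟩
    refine ⟨f A, hf A (by simp), _, ⟨f, fun B hB => hf B (by simp [hB]), rfl⟩, ?_⟩
    simp
  · rintro ⟨a, ha, _, ⟨f, hf, rfl⟩, rfl⟩
    by_cases hA : A ∈ Γ
    · refine ⟨Function.update f A (a ∪ f A), ?_, ?_⟩
      · intro B hB
        by_cases hBA : B = A
        · subst hBA
          simpa using union_mem_of_closed (RSem_closed hσ B).1 ha (hf _ hA)
        · simp only [Function.update_of_ne hBA]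
          exact hf B (by simpa [hBA] using hB)
      · ext x
        simp only [Set.mem_union, Set.mem_iUnion, Finset.mem_insert, exists_prop]
        constructor
        · rintro (hx | ⟨B, hB, hx⟩)
          · exact ⟨A, Or.inl rfl, by simp [hx]⟩
          · refine ⟨B, Or.inr hB, ?_⟩
            by_cases hBA : B = A
            · subst hBA; simp [hx]
            · simpa [Function.update_of_ne hBA] using hx
        · rintro ⟨B, hB, hx⟩
          by_cases hBA : B = A
          · subst hBA
            simp at hx
            rcases hx with hx | hx
            · exact Or.inl hx
            · exact Or.inr ⟨_, hA, hx⟩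
          · simp only [Function.update_of_ne hBA] at hx
            exact Or.inr ⟨B, by simpa [hBA] using hB, hx⟩
    · have hne : ∀ B ∈ Γ, B ≠ A := fun B hB h => hA (h ▸ hB)
      refine ⟨Function.update f A a, ?_, ?_⟩
      · intro B hB
        by_cases hBA : B = A
        · subst hBA; simpa using ha
        · simp only [Function.update_of_ne hBA]
          exact hf B (by simpa [hBA] using hB)
      · rw [Finset.set_biUnion_insert]
        simp only [Function.update_self]
        congr 1
        refine Set.iUnion₂_congr fun B hB => ?_
        rw [Function.update_of_ne (hne B hB)]

theorem RDatumTM_insert (Γ : Finset Fml) (ρ : Datum) :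
    RDatumTM σ (insert Γ ρ) = RCl (RCompTM σ Γ ∪ RDatumTM σ ρ) := by
  unfold RDatumTM
  rw [RCl_union', Finset.set_biUnion_insert]

theorem RSem_conj1 (A B : Fml) :
    (RSem σ (.conj A B)).1 = RCl (Ten (RSem σ A).1 (RSem σ B).1) := rfl
theorem RSem_conj2 (A B : Fml) :
    (RSem σ (.conj A B)).2 = RCl ((RSem σ A).2 ∪ (RSem σ B).2) := rfl
theorem RSem_disj1 (A B : Fml) :
    (RSem σ (.disj A B)).1 = RCl ((RSem σ A).1 ∪ (RSem σ B).1) := rfl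
theorem RSem_disj2 (A B : Fml) :
    (RSem σ (.disj A B)).2 = RCl (Ten (RSem σ A).2 (RSem σ B).2) := rfl
theorem RSem_neg1 (A : Fml) : (RSem σ (.neg A)).1 = (RSem σ A).2 := rfl
theorem RSem_neg2 (A : Fml) : (RSem σ (.neg A)).2 = (RSem σ A).1 := rfl

theorem GStep_sound (hσ : ∀ p, RCl (σ p).1 = (σ p).1 ∧ RCl (σ p).2 = (σ p).2)
    {α β : Datum} (h : GStep α β) : RDatumTM σ α = RDatumTM σ β := by
  cases h <;>
  simp only [RDatumTM_insert, RCompTM_insert hσ, RSem_conj1, RSem_conj2, RSem_disj1,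
    RSem_disj2, RSem_neg1, RSem_neg2, RCl_union, RCl_union', RCl_Ten, RCl_Ten', Ten_assoc,
    Ten_union, Set.union_assoc]

theorem GSteps_sound (hσ : ∀ p, RCl (σ p).1 = (σ p).1 ∧ RCl (σ p).2 = (σ p).2)
    {α β : Datum} (h : ReflTransGen GStep α β) : RDatumTM σ α = RDatumTM σ β := by
  induction h with
  | refl => rfl
  | tail _ h ih => exact ih.trans (GStep_sound hσ h)

/-! ### Normal forms -/

def FLit (A : Fml) : Prop := ∃ p, A = .var p ∨ A = .neg (.var p)

def FNormal (α : Datum) : Prop := ∀ Γ ∈ α, ∀ A ∈ Γ, FLit A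

def fw : Fml → ℕ
  | .var _ => 1
  | .neg A => fw A + 1
  | .conj A B => fw A + fw B + 2
  | .disj A B => fw A + fw B + 2

theorem sum_insert_le' (A : Fml) (Γ : Finset Fml) :
    ∑ B ∈ insert A Γ, fw B ≤ fw A + ∑ B ∈ Γ, fw B := by
  by_cases h : A ∈ Γ
  · simp [h]
  · rw [Finset.sum_insert h]

def CNorm (Γ : Finset Fml) : Prop :=
  ∃ δ : Datum, FNormal δ ∧ ∀ ρ, ReflTransGen GStep (insert Γ ρ) (δ ∪ ρ)

theorem CNorm_one {Γ Γ' : Finset Fml} (h : ∀ ρ, GStep (insert Γ ρ) (insert Γ' ρ))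
    (h' : CNorm Γ') : CNorm Γ := by
  obtain ⟨δ, hδ, hs⟩ := h'
  exact ⟨δ, hδ, fun ρ => ReflTransGen.head (h ρ) (hs ρ)⟩

theorem CNorm_two {Γ Γ₁ Γ₂ : Finset Fml}
    (h : ∀ ρ, GStep (insert Γ ρ) (insert Γ₁ (insert Γ₂ ρ)))
    (h₁ : CNorm Γ₁) (h₂ : CNorm Γ₂) : CNorm Γ := by
  obtain ⟨δ₁, hδ₁, hs₁⟩ := h₁
  obtain ⟨δ₂, hδ₂, hs₂⟩ := h₂
  refine ⟨δ₂ ∪ δ₁, ?_, fun ρ => ReflTransGen.head (h ρ) ((hs₁ _).trans ?_)⟩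
  · intro Γ hΓ
    rcases Finset.mem_union.1 hΓ with h | h
    · exact hδ₂ _ h
    · exact hδ₁ _ h
  · rw [Finset.union_insert, Finset.union_assoc]
    exact hs₂ _

theorem comp_norm (n : ℕ) : ∀ Γ : Finset Fml, ∑ B ∈ Γ, fw B = n → CNorm Γ := by
  induction n using Nat.strong_induction_on with
  | _ n ih =>
  intro Γ hn
  by_cases hl : ∀ A ∈ Γ, FLit A
  · refine ⟨{Γ}, ?_, fun ρ => ?_⟩
    · intro Δ hΔ
      rw [Finset.mem_singleton.1 hΔ]
      exact hl
    · rw [← Finset.insert_eq]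
  · push Not at hl
    obtain ⟨C, hC, hCl⟩ := hl
    have hΓ : Γ = insert C (Γ.erase C) := (Finset.insert_erase hC).symm
    have hsum : fw C + ∑ B ∈ Γ.erase C, fw B = n := by
      rw [← hn]; exact Finset.add_sum_erase _ _ hC
    generalize Γ.erase C = Δ at hΓ hsum
    have one : ∀ A, fw A < fw C → CNorm (insert A Δ) := fun A hA =>
      ih _ (by have := sum_insert_le' A Δ; omega) _ rfl
    have two : ∀ A B, fw A + fw B < fw C → CNorm (insert A (insert B Δ)) := fun A B hA =>
      ih _ (by
        have := sum_insert_le' A (insert B Δ)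
        have := sum_insert_le' B Δ
        omega) _ rfl
    rw [hΓ]
    clear hn hC hΓ hsum
    match C with
    | .var p => exact (hCl ⟨p, Or.inl rfl⟩).elim
    | .neg (.var p) => exact (hCl ⟨p, Or.inr rfl⟩).elim
    | .neg (.neg A) =>
      exact CNorm_one (GStep.negneg Δ A) (one A (by simp only [fw]; omega))
    | .neg (.conj A B) =>
      exact CNorm_two (GStep.negconj Δ A B) (one _ (by simp only [fw]; omega))
        (one _ (by simp only [fw]; omega))
    | .neg (.disj A B) =>
      exact CNorm_one (GStep.negdisj Δ A B) (two _ _ (by simp only [fw]; omega))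
    | .conj A B =>
      exact CNorm_one (GStep.conj Δ A B) (two _ _ (by simp only [fw]; omega))
    | .disj A B =>
      exact CNorm_two (GStep.disj Δ A B) (one _ (by simp only [fw]; omega))
        (one _ (by simp only [fw]; omega))

theorem datum_norm (α : Datum) :
    ∃ δ : Datum, FNormal δ ∧ ∀ ρ, ReflTransGen GStep (α ∪ ρ) (δ ∪ ρ) := by
  induction α using Finset.induction_on with
  | empty => exact ⟨∅, by simp [FNormal], fun ρ => ReflTransGen.refl⟩
  | insert Γ α _ ih =>
    obtain ⟨δ₁, hδ₁, hs₁⟩ := ih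
    obtain ⟨δ₂, hδ₂, hs₂⟩ := comp_norm _ Γ rfl
    refine ⟨δ₁ ∪ δ₂, ?_, fun ρ => ?_⟩
    · intro Γ hΓ
      rcases Finset.mem_union.1 hΓ with h | h
      · exact hδ₁ _ h
      · exact hδ₂ _ h
    · rw [Finset.insert_union]
      refine (hs₂ _).trans ?_
      rw [Finset.union_left_comm, Finset.union_assoc]
      exact hs₁ _

/-! ### The canonical model -/

def canon (p : ℕ) : Set (Set Fml) × Set (Set Fml) := ({{.var p}}, {{.neg (.var p)}})

theorem regular_singleton {S : Type} (x : Set S) :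
    FusCl {x} = {x} ∧ IntCl {x} = {x} := by
  constructor
  · ext s
    constructor
    · rintro ⟨Y, hY, hY', rfl⟩
      rw [(Set.Nonempty.subset_singleton_iff hY').1 hY]
      simp
    · rintro rfl
      exact ⟨{s}, subset_rfl, by simp, by simp⟩
  · ext s
    constructor
    · rintro ⟨a, rfl, b, rfl, h1, h2⟩
      exact Set.Subset.antisymm h2 h1
    · rintro rfl
      exact ⟨s, rfl, s, rfl, subset_rfl, subset_rfl⟩

theorem canon_regular (p : ℕ) : RegularProp (canon p) := by
  refine ⟨?_, by simp [canon], by simp [canon], (regular_singleton _).1, (regular_singleton _).2,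
    (regular_singleton _).1, (regular_singleton _).2⟩
  simp [canon]

theorem canon_closed (p : ℕ) :
    RCl (canon p).1 = (canon p).1 ∧ RCl (canon p).2 = (canon p).2 :=
  ⟨RCl_singleton _, RCl_singleton _⟩

theorem canon_lit {A : Fml} (h : FLit A) : (RSem canon A).1 = {{A}} := by
  obtain ⟨p, rfl | rfl⟩ := h <;> rfl

theorem canon_comp {Γ : Finset Fml} (h : ∀ A ∈ Γ, FLit A) :
    RCompTM canon Γ = {(Γ : Set Fml)} := by
  unfold RCompTM
  rw [← RCl_singleton]
  congr 1
  ext s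
  constructor
  · rintro ⟨f, hf, rfl⟩
    have : ∀ A ∈ Γ, f A = {A} := fun A hA => by
      have := hf A hA
      rwa [canon_lit (h A hA)] at this
    rw [Set.mem_singleton_iff, Set.iUnion₂_congr this]
    ext x; simp
  · rintro rfl
    refine ⟨fun A => {A}, fun A hA => by rw [canon_lit (h A hA)]; rfl, ?_⟩
    ext x; simp

theorem canon_datum {α : Datum} (h : FNormal α) :
    RDatumTM canon α = RCl {s | ∃ Γ ∈ α, s = (Γ : Set Fml)} := by
  unfold RDatumTM
  congr 1
  rw [Set.iUnion₂_congr (fun Γ hΓ => canon_comp (h Γ hΓ))]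
  ext s; simp

/-! ### Deductions -/

theorem RTDCStep_symm {α β : Datum} (h : RTDCStep α β) : RTDCStep β α := by
  unfold RTDCStep at *
  tauto

abbrev RD : Datum → Datum → Prop := ReflTransGen RTDCStep

theorem RD_symm {α β : Datum} (h : RD α β) : RD β α := by
  induction h with
  | refl => exact ReflTransGen.refl
  | tail _ h ih => exact ReflTransGen.head (RTDCStep_symm h) ih

theorem RD_of_G {α β : Datum} (h : ReflTransGen GStep α β) : RD α β := by
  induction h with
  | refl => exact ReflTransGen.refl
  | tail _ h ih => exact ReflTransGen.tail ih (Or.inl h)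

def Absorb (α : Datum) (Γ : Finset Fml) : Prop := ∀ α', α ⊆ α' → RD α' (insert Γ α')

theorem absorb_mem {α : Datum} {Γ : Finset Fml} (h : Γ ∈ α) : Absorb α Γ := by
  intro α' hα
  rw [Finset.insert_eq_of_mem (hα h)]

theorem absorb_of_two {α : Datum} {Γ Δ Θ : Finset Fml} (h₁ : Absorb α Γ) (h₂ : Absorb α Δ)
    (hs : ∀ ρ, RTDCStep (insert Γ (insert Δ ρ)) (insert Γ (insert Δ (insert Θ ρ)))) :
    Absorb α Θ := by
  intro α' hα
  have hα1 : α ⊆ insert Θ α' := hα.trans (Finset.subset_insert _ _)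
  refine (h₂ _ hα).trans ((h₁ _ (hα.trans (Finset.subset_insert _ _))).trans ?_)
  refine ReflTransGen.head (hs _) (RD_symm ?_)
  exact (h₂ _ hα1).trans (h₁ _ (hα1.trans (Finset.subset_insert _ _)))

theorem absorb_union {α : Datum} {Γ Δ : Finset Fml} (h₁ : Absorb α Γ) (h₂ : Absorb α Δ) :
    Absorb α (Γ ∪ Δ) :=
  absorb_of_two h₁ h₂ fun ρ => Or.inr (Or.inr (Or.inl ⟨Γ, Δ, ρ, rfl, rfl⟩))

theorem absorb_int {α : Datum} {Γ Δ Θ : Finset Fml} (h₁ : Absorb α Γ) (h₂ : Absorb α Δ)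
    (hl : Γ ⊆ Θ) (hr : Θ ⊆ Δ) : Absorb α Θ := by
  refine absorb_of_two h₁ h₂ fun ρ => Or.inr (Or.inr (Or.inr (Or.inr (Or.inl
    ⟨Γ, Θ, Δ, ρ, ?_, ?_⟩))))
  · rw [Finset.union_eq_right.2 hl, Finset.union_eq_right.2 hr]
  · rw [Finset.union_eq_right.2 hl, Finset.union_eq_right.2 hr, Finset.insert_comm Θ Δ]

theorem absorb_sup {α F : Datum} (hF : F.Nonempty) (h : F ⊆ α) : Absorb α (F.sup id) := by
  induction hF using Finset.Nonempty.cons_induction with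
  | singleton a => simpa using absorb_mem (h (by simp))
  | cons a s ha hs ih =>
    rw [Finset.sup_cons]
    exact absorb_union (absorb_mem (h (by simp)))
      (ih (fun x hx => h (by simp [hx])))

theorem absorb_fus {α : Datum} {Y : Set (Set Fml)} (hY : Y ⊆ {s | ∃ Γ ∈ α, s = (Γ : Set Fml)})
    (hn : Y.Nonempty) : ∃ Γ : Finset Fml, (Γ : Set Fml) = ⋃₀ Y ∧ Absorb α Γ := by
  classical
  refine ⟨(α.filter (fun Γ : Finset Fml => (Γ : Set Fml) ∈ Y)).sup id, ?_,
    absorb_sup ?_ (Finset.filter_subset _ _)⟩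
  · ext x
    simp only [Finset.mem_coe, Finset.mem_sup, Finset.mem_filter, id, Set.mem_sUnion]
    constructor
    · rintro ⟨Γ, ⟨_, h⟩, hx⟩
      exact ⟨_, h, hx⟩
    · rintro ⟨t, ht, hx⟩
      obtain ⟨Γ, hΓ, rfl⟩ := hY ht
      exact ⟨Γ, ⟨hΓ, ht⟩, hx⟩
  · obtain ⟨t, ht⟩ := hn
    obtain ⟨Γ, hΓ, rfl⟩ := hY ht
    exact ⟨Γ, by simp [hΓ, ht]⟩

theorem absorb_all {α β : Datum} (h : ∀ Γ ∈ β, Absorb α Γ) : RD α (β ∪ α) := by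
  induction β using Finset.induction_on with
  | empty => simpa using ReflTransGen.refl
  | insert Γ β _ ih =>
    rw [Finset.insert_union]
    exact (ih fun Δ hΔ => h Δ (by simp [hΔ])).trans
      (h Γ (by simp) _ Finset.subset_union_right)

theorem norm_half {α β : Datum} (hα : FNormal α) (hβ : FNormal β)
    (h : RDatumTM canon α = RDatumTM canon β) : RD α (β ∪ α) := by
  apply absorb_all
  intro Γ hΓ
  rw [canon_datum hα, canon_datum hβ] at h
  have hm : (Γ : Set Fml) ∈ RCl {s | ∃ Γ ∈ β, s = (Γ : Set Fml)} := subset_RCl _ ⟨Γ, hΓ, rfl⟩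
  rw [← h] at hm
  obtain ⟨A, hA, B, hB, hA', hB', h1, h2⟩ := mem_RCl.1 hm
  obtain ⟨X, hX, hXa⟩ := absorb_fus hA hA'
  obtain ⟨Y, hY, hYa⟩ := absorb_fus hB hB'
  rw [← hX] at h1
  rw [← hY] at h2
  exact absorb_int hXa hYa (by exact_mod_cast h1) (by exact_mod_cast h2)

end RTDCProof

/-- Completeness of RTDC: if α ≃_RT β then β is RTDC-deducible from α. -/
theorem rtdc_completeness (α β : Datum) (h : RTEquiv α β) :
    Relation.ReflTransGen RTDCStep α β := by
  obtain ⟨α', hα, sα⟩ := datum_norm α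
  obtain ⟨β', hβ, sβ⟩ := datum_norm β
  have sα := sα ∅
  have sβ := sβ ∅
  rw [Finset.union_empty, Finset.union_empty] at sα sβ
  have key : RDatumTM canon α' = RDatumTM canon β' := by
    rw [← GSteps_sound canon_closed sα, ← GSteps_sound canon_closed sβ]
    exact h _ canon canon_regular
  have h1 := norm_half hα hβ key
  have h2 := norm_half hβ hα key.symm
  rw [Finset.union_comm] at h2
  exact (RD_of_G sα).trans (h1.trans ((RD_symm h2).trans (RD_symm (RD_of_G sβ))))
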